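/- (Hölder-type inequality with s = ∞, in the form used for Mazur maps.) Let 0<p<q≤1 and 0<R<p. There is a constant C, depending only on p, q, R, such that for every n, every self-adjoint x ∈ M_n(ℂ) with operator norm ‖x‖_∞ ≤ 1, every positive semidefinite f ∈ M_n(ℂ) with ‖f‖_p = 1, and each choice of sign ±, one has ‖x f^{p/q} ± f^{p/q} x‖_q ≤ C ‖x f ± f x‖_p^{pR/(2q)}. -/

import Mathlib

open scoped BigOperators
open Matrix MeasureTheory
open scoped ComplexOrder

/-- `A^β` for a Hermitian (in practice positive semidefinite) matrix `A`, via the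
spectral functional calculus (with the conventions of `Real.rpow` on eigenvalues,
in particular `0 ^ β = 0` for `β ≠ 0`), extended by `0` to non-Hermitian matrices. -/
noncomputable def posPow {ι : Type*} [Fintype ι] [DecidableEq ι]
    (A : Matrix ι ι ℂ) (β : ℝ) : Matrix ι ι ℂ :=
  if hA : A.IsHermitian then hA.cfc (fun t => t ^ β) else 0

/-- Schatten `p`-(quasi)norm of a complex matrix: `(Tr((A*A)^(p/2)))^(1/p)`. -/
noncomputable def schattenNorm {ι : Type*} [Fintype ι] [DecidableEq ι]
    (p : ℝ) (A : Matrix ι ι ℂ) : ℝ :=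
  ((posPow (Aᴴ * A) (p / 2)).trace.re) ^ (1 / p)

/-- Operator norm of a matrix, acting on the Euclidean space. -/
noncomputable def opNorm {ι : Type*} [Fintype ι] [DecidableEq ι]
    (A : Matrix ι ι ℂ) : ℝ :=
  ‖Matrix.toEuclideanCLM (𝕜 := ℂ) A‖

/-- The quantity `|||x|||_p` for `0 < p ≤ 2`: the infimum of
`‖(∑ aₖ*aₖ)^(1/2)‖_p + ‖(∑ bₖbₖ*)^(1/2)‖_p` over decompositions `xₖ = aₖ + bₖ`. -/
noncomputable def tripleNorm {n N : ℕ} (p : ℝ)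
    (x : Fin N → Matrix (Fin n) (Fin n) ℂ) : ℝ :=
  sInf { r : ℝ | ∃ a b : Fin N → Matrix (Fin n) (Fin n) ℂ,
    (∀ k, x k = a k + b k) ∧
    r = schattenNorm p (posPow (∑ k, (a k)ᴴ * a k) (1/2))
        + schattenNorm p (posPow (∑ k, b k * (b k)ᴴ) (1/2)) }

/-- `E_ε ‖∑ ε_k x_k‖_p ^ p`, the average over a uniformly random choice of signs. -/
noncomputable def radAvg {n N : ℕ} (p : ℝ)
    (x : Fin N → Matrix (Fin n) (Fin n) ℂ) : ℝ :=
  (1 / 2 ^ N) * ∑ ε : Fin N → Bool,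
    (schattenNorm p (∑ k, (if ε k then (1 : ℂ) else -1) • x k)) ^ p

section FrobeniusAndSingularValues

open scoped Matrix.Norms.L2Operator

variable {ι : Type*} [Fintype ι]

/-- The square of the Hilbert–Schmidt norm. -/
noncomputable def frobSq (A : Matrix ι ι ℂ) : ℝ := ∑ i, ∑ j, ‖A i j‖ ^ 2

lemma conjTranspose_mul_self_diag (A : Matrix ι ι ℂ) (j : ι) :
    (Aᴴ * A) j j = ((∑ i, ‖A i j‖ ^ 2 : ℝ) : ℂ) := by
  simp only [Matrix.mul_apply, Matrix.conjTranspose_apply, Complex.ofReal_sum]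
  refine Finset.sum_congr rfl fun i _ => ?_
  rw [Complex.star_def, Complex.conj_mul']; push_cast; rfl

lemma trace_conjTranspose_mul_self (A : Matrix ι ι ℂ) : (Aᴴ * A).trace = (frobSq A : ℂ) := by
  rw [frobSq, Finset.sum_comm, Matrix.trace, Complex.ofReal_sum]
  exact Finset.sum_congr rfl fun j _ => conjTranspose_mul_self_diag A j

lemma frobSq_mono {A B : Matrix ι ι ℂ} (h : ∀ i j, ‖A i j‖ ≤ ‖B i j‖) : frobSq A ≤ frobSq B :=
  Finset.sum_le_sum fun i _ => Finset.sum_le_sum fun j _ => by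
    gcongr; exact h i j

variable [DecidableEq ι]

/-- The squares of the singular values. -/
noncomputable def svSq (A : Matrix ι ι ℂ) : ι → ℝ :=
  (isHermitian_conjTranspose_mul_self A).eigenvalues

lemma svSq_nonneg (A : Matrix ι ι ℂ) (i : ι) : 0 ≤ svSq A i :=
  (posSemidef_conjTranspose_mul_self A).eigenvalues_nonneg i

lemma svSq_rpow_sum_nonneg (A : Matrix ι ι ℂ) (s : ℝ) : 0 ≤ ∑ i, svSq A i ^ s :=
  Finset.sum_nonneg fun i _ => Real.rpow_nonneg (svSq_nonneg A i) _

lemma trace_posPow {A : Matrix ι ι ℂ} (hA : A.IsHermitian) (s : ℝ) :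
    (posPow A s).trace.re = ∑ i, hA.eigenvalues i ^ s := by
  rw [posPow, dif_pos hA, Matrix.IsHermitian.cfc, Unitary.conjStarAlgAut_apply,
    Matrix.trace_mul_cycle, Unitary.coe_star_mul_self, one_mul, Matrix.trace_diagonal]
  simp

lemma schattenNorm_eq (p : ℝ) (A : Matrix ι ι ℂ) :
    schattenNorm p A = (∑ i, svSq A i ^ (p / 2)) ^ (1 / p) := by
  rw [schattenNorm, trace_posPow (isHermitian_conjTranspose_mul_self A)]; rfl

lemma frobSq_mul_unitary (A : Matrix ι ι ℂ) {U : Matrix ι ι ℂ} (hU : U * star U = 1) :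
    frobSq (A * U) = frobSq A := by
  have h : (((A * U)ᴴ * (A * U)).trace) = (Aᴴ * A).trace := by
    rw [Matrix.conjTranspose_mul, Matrix.mul_assoc, Matrix.trace_mul_comm, ← Matrix.star_eq_conjTranspose U,
      Matrix.mul_assoc, Matrix.mul_assoc, hU, Matrix.mul_one]
  rw [trace_conjTranspose_mul_self, trace_conjTranspose_mul_self] at h
  exact_mod_cast h

lemma column_sq_le_opNorm_sq (A : Matrix ι ι ℂ) (j : ι) : ∑ i, ‖A i j‖ ^ 2 ≤ ‖A‖ ^ 2 := by
  have h := A.l2_opNorm_mulVec (EuclideanSpace.single j 1)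
  have h2 : ‖(EuclideanSpace.equiv ι ℂ).symm <| A *ᵥ (EuclideanSpace.single j (1 : ℂ))‖ ^ 2
      = ∑ i, ‖A i j‖ ^ 2 := by
    rw [EuclideanSpace.norm_sq_eq]
    simp
  rw [← h2]
  gcongr
  simpa using h

lemma opNorm_le_one_of_star_mul_self {W : Matrix ι ι ℂ} (hW : star W * W = 1) : ‖W‖ ≤ 1 := by
  have h1 := Matrix.l2_opNorm_conjTranspose_mul_self W
  have h2 : Wᴴ * W = diagonal fun _ => 1 := by
    rw [Matrix.diagonal_one]; exact hW
  have h3 : ‖(fun _ => 1 : ι → ℂ)‖ ≤ 1 :=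
    (pi_norm_le_iff_of_nonneg zero_le_one).2 fun _ => by simp
  rw [h2, Matrix.l2_opNorm_diagonal] at h1
  nlinarith [norm_nonneg W]

/-- A matrix of operator norm at most `τ` which differs from `H` by `G` has Hilbert–Schmidt norm
controlled by that of `G` and the rank of `H`. -/
lemma frobSq_le_add_rank {T G H : Matrix ι ι ℂ} (h : T = G + H) {τ : ℝ}
    (hτ : ‖T‖ ≤ τ) : frobSq T ≤ frobSq G + τ ^ 2 * H.rank := by
  have hH := isHermitian_conjTranspose_mul_self H
  set W : Matrix ι ι ℂ := (hH.eigenvectorUnitary : Matrix ι ι ℂ) with hW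
  have hWW : W * star W = 1 := Unitary.coe_mul_star_self _
  have hWn : ‖W‖ ≤ 1 := opNorm_le_one_of_star_mul_self (Unitary.coe_star_mul_self _)
  have hd : (H * W)ᴴ * (H * W) = diagonal (fun i => (hH.eigenvalues i : ℂ)) := by
    have := hH.conjStarAlgAut_star_eigenvectorUnitary
    rw [Unitary.conjStarAlgAut_star_apply] at this
    rw [Matrix.conjTranspose_mul, ← Matrix.star_eq_conjTranspose W]
    simp only [Matrix.mul_assoc] at this ⊢
    exact this
  have hcol : ∀ j, hH.eigenvalues j = 0 → ∀ i, (H * W) i j = 0 := by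
    intro j hj i
    have h1 := conjTranspose_mul_self_diag (H * W) j
    rw [hd, diagonal_apply_eq, hj, Complex.ofReal_inj] at h1
    have h2 := (Finset.sum_eq_zero_iff_of_nonneg (fun i _ => by positivity)).1 h1.symm i
      (Finset.mem_univ i)
    simpa using h2
  have hrank : (H.rank : ℝ) = ∑ j, if hH.eigenvalues j = 0 then 0 else 1 := by
    rw [← Matrix.rank_conjTranspose_mul_self, hH.rank_eq_card_non_zero_eigs,
      Fintype.card_subtype, Finset.sum_ite]
    simp
  rw [← frobSq_mul_unitary T hWW, ← frobSq_mul_unitary G hWW, hrank, frobSq, frobSq,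
    Finset.sum_comm, Finset.sum_comm (f := fun i j => ‖(G * W) i j‖ ^ 2), Finset.mul_sum,
    ← Finset.sum_add_distrib]
  refine Finset.sum_le_sum fun j _ => ?_
  split_ifs with hj
  · rw [mul_zero, add_zero]
    refine le_of_eq (Finset.sum_congr rfl fun i _ => ?_)
    rw [h, Matrix.add_mul, Matrix.add_apply, hcol j hj i, add_zero]
  · have h1 := column_sq_le_opNorm_sq (T * W) j
    have h2 : ‖T * W‖ ≤ τ := (Matrix.l2_opNorm_mul T W).trans
      ((mul_le_of_le_one_right (norm_nonneg _) hWn).trans hτ)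
    have h3 : ‖T * W‖ ^ 2 ≤ τ ^ 2 := by gcongr
    have h4 : 0 ≤ ∑ i, ‖(G * W) i j‖ ^ 2 := by positivity
    linarith

lemma conjTranspose_mul_self_diagonalized (A : Matrix ι ι ℂ) :
    ∃ U : Matrix ι ι ℂ, U * star U = 1 ∧ star U * U = 1 ∧
      (A * U)ᴴ * (A * U) = diagonal (fun i => (svSq A i : ℂ)) := by
  have hA := isHermitian_conjTranspose_mul_self A
  refine ⟨hA.eigenvectorUnitary, Unitary.coe_mul_star_self _, Unitary.coe_star_mul_self _, ?_⟩
  have := hA.conjStarAlgAut_star_eigenvectorUnitary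
  rw [Unitary.conjStarAlgAut_star_apply] at this
  rw [Matrix.conjTranspose_mul, ← Matrix.star_eq_conjTranspose (hA.eigenvectorUnitary : Matrix ι ι ℂ)]
  simp only [Matrix.mul_assoc] at this ⊢
  exact this

lemma conjTranspose_mul_diagonal_mul_self {B : Matrix ι ι ℂ} {l : ι → ℝ}
    (hB : Bᴴ * B = diagonal (fun i => (l i : ℂ))) (k : ι → ℝ) :
    (B * diagonal (fun i => (k i : ℂ)))ᴴ * (B * diagonal (fun i => (k i : ℂ))) =
      diagonal (fun i => ((k i ^ 2 * l i : ℝ) : ℂ)) := by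
  rw [Matrix.conjTranspose_mul, Matrix.mul_assoc, ← Matrix.mul_assoc _ B, hB,
    Matrix.diagonal_conjTranspose, Matrix.diagonal_mul_diagonal, Matrix.diagonal_mul_diagonal]
  congr 1
  funext i
  simp
  ring

lemma frobSq_mul_diagonal_of_gram {B : Matrix ι ι ℂ} {l : ι → ℝ}
    (hB : Bᴴ * B = diagonal (fun i => (l i : ℂ))) (k : ι → ℝ) :
    frobSq (B * diagonal (fun i => (k i : ℂ))) = ∑ i, k i ^ 2 * l i := by
  have h := trace_conjTranspose_mul_self (B * diagonal (fun i => (k i : ℂ)))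
  rw [conjTranspose_mul_diagonal_mul_self hB, Matrix.trace_diagonal] at h
  exact_mod_cast h.symm

/-- Upper bound for the `K`-functional type quantity `∑ min (s_m ^ 2) (t ^ 2)`. -/
lemma sum_min_svSq_le {A G H : Matrix ι ι ℂ} (h : A = G + H) {t : ℝ} (ht : 0 < t) :
    ∑ i, min (svSq A i) (t ^ 2) ≤ frobSq G + t ^ 2 * H.rank := by
  obtain ⟨U, hU, -, hAU⟩ := conjTranspose_mul_self_diagonalized A
  set k : ι → ℝ := fun i => if svSq A i ≤ t ^ 2 then 1 else t / √(svSq A i) with hk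
  have hk0 : ∀ i, 0 ≤ k i := fun i => by simp only [hk]; split_ifs <;> positivity
  have hk1 : ∀ i, k i ≤ 1 := by
    intro i
    simp only [hk]
    split_ifs with hi
    · exact le_rfl
    · exact div_le_one_of_le₀ (Real.le_sqrt_of_sq_le (not_le.1 hi).le) (Real.sqrt_nonneg _)
  have hkl : ∀ i, k i ^ 2 * svSq A i = min (svSq A i) (t ^ 2) := by
    intro i
    simp only [hk]
    split_ifs with hi
    · rw [min_eq_left hi]; ring
    · have : 0 < svSq A i := lt_trans (by positivity) (not_le.1 hi)
      rw [min_eq_right (not_le.1 hi).le, div_pow, Real.sq_sqrt this.le]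
      field_simp
  set Δ : Matrix ι ι ℂ := diagonal (fun i => (k i : ℂ)) with hΔ
  have hsum : A * U * Δ = G * U * Δ + H * U * Δ := by rw [h, Matrix.add_mul, Matrix.add_mul]
  have hnorm : ‖A * U * Δ‖ ≤ t := by
    have h1 := Matrix.l2_opNorm_conjTranspose_mul_self (A * U * Δ)
    rw [hΔ, conjTranspose_mul_diagonal_mul_self hAU, Matrix.l2_opNorm_diagonal] at h1
    refine abs_le_of_sq_le_sq' (a := ‖A * U * Δ‖) ?_ ht.le |>.2
    rw [sq, hΔ, ← h1, pi_norm_le_iff_of_nonneg (by positivity)]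
    intro i
    rw [hkl, Complex.norm_real, Real.norm_of_nonneg (le_min (svSq_nonneg A i) (by positivity))]
    exact min_le_right _ _
  have hmain := frobSq_le_add_rank hsum hnorm
  rw [hΔ, frobSq_mul_diagonal_of_gram hAU, ← hΔ] at hmain
  simp only [hkl] at hmain
  have hG : frobSq (G * U * Δ) ≤ frobSq G := by
    rw [← frobSq_mul_unitary G hU]
    refine frobSq_mono fun i j => ?_
    rw [hΔ, Matrix.mul_diagonal, norm_mul, Complex.norm_real, Real.norm_of_nonneg (hk0 j)]
    exact mul_le_of_le_one_right (norm_nonneg _) (hk1 j)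
  have hH : ((H * U * Δ).rank : ℝ) ≤ H.rank := by
    exact_mod_cast (Matrix.rank_mul_le_left _ _).trans (Matrix.rank_mul_le_left _ _)
  have : t ^ 2 * ((H * U * Δ).rank : ℝ) ≤ t ^ 2 * H.rank := by gcongr
  linarith

lemma rank_diagonal_indicator (s : ι → Prop) [DecidablePred s] :
    ((diagonal (fun i => ((if s i then 1 else 0 : ℝ) : ℂ))).rank : ℝ) =
      ∑ i, if s i then 1 else 0 := by
  rw [Matrix.rank_diagonal, Fintype.card_subtype]
  simp

/-- The spectral decomposition attains `∑ min (s_m ^ 2) (t ^ 2)`. -/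
lemma exists_decomposition_svSq (A : Matrix ι ι ℂ) (t : ℝ) :
    ∃ G H : Matrix ι ι ℂ, A = G + H ∧
      frobSq G + t ^ 2 * H.rank ≤ ∑ i, min (svSq A i) (t ^ 2) := by
  obtain ⟨U, hU, -, hAU⟩ := conjTranspose_mul_self_diagonalized A
  set k : ι → ℝ := fun i => if svSq A i ≤ t ^ 2 then 1 else 0 with hk
  set l : ι → ℝ := fun i => if ¬ svSq A i ≤ t ^ 2 then 1 else 0 with hl
  refine ⟨A * U * diagonal (fun i => (k i : ℂ)) * star U,
    A * U * diagonal (fun i => (l i : ℂ)) * star U, ?_, ?_⟩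
  · rw [← Matrix.add_mul, ← Matrix.mul_add, Matrix.diagonal_add]
    have : (fun i => (k i : ℂ) + (l i : ℂ)) = fun _ => 1 := by
      funext i; simp only [hk, hl]; split_ifs <;> simp
    rw [this, Matrix.diagonal_one, Matrix.mul_one, Matrix.mul_assoc, hU, Matrix.mul_one]
  · have hG : frobSq (A * U * diagonal (fun i => (k i : ℂ)) * star U) =
        ∑ i, k i ^ 2 * svSq A i := by
      rw [← frobSq_mul_diagonal_of_gram hAU, frobSq_mul_unitary]
      rw [star_star]
      exact mul_eq_one_comm.1 hU
    have hH : ((A * U * diagonal (fun i => (l i : ℂ)) * star U).rank : ℝ) ≤ ∑ i, l i := by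
      rw [hl, ← rank_diagonal_indicator]
      exact_mod_cast (Matrix.rank_mul_le_left _ _).trans (Matrix.rank_mul_le_right _ _)
    have : t ^ 2 * ((A * U * diagonal (fun i => (l i : ℂ)) * star U).rank : ℝ) ≤
      t ^ 2 * ∑ i, l i := by gcongr
    rw [hG]
    refine (add_le_add le_rfl this).trans (le_of_eq ?_)
    rw [Finset.mul_sum, ← Finset.sum_add_distrib]
    refine Finset.sum_congr rfl fun i _ => ?_
    simp only [hk, hl]
    split_ifs with hi
    · rw [min_eq_left hi]; ring
    · rw [min_eq_right (not_le.1 hi).le]; ring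

end FrobeniusAndSingularValues

section LayerCake

lemma integral_rpow_mul_min {p l : ℝ} (hp : 0 < p) (hp2 : p < 2) (hl : 0 ≤ l) :
    IntegrableOn (fun t : ℝ => t ^ (p - 3) * min l (t ^ 2)) (Set.Ioi 0) ∧
      ∫ t in Set.Ioi (0 : ℝ), t ^ (p - 3) * min l (t ^ 2) = (1 / p + 1 / (2 - p)) * l ^ (p / 2) := by
  rcases hl.eq_or_lt with rfl | hl
  · have h : ∀ t : ℝ, t ^ (p - 3) * min 0 (t ^ 2) = 0 := fun t => by
      rw [min_eq_left (sq_nonneg t), mul_zero]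
    simp only [h]
    refine ⟨integrableOn_zero, ?_⟩
    rw [Real.zero_rpow (by positivity)]
    simp
  set s := √l with hs
  have hs0 : 0 < s := Real.sqrt_pos.2 hl
  have hsl : s ^ 2 = l := Real.sq_sqrt hl.le
  have e1 : Set.EqOn (fun t : ℝ => t ^ (p - 3) * min l (t ^ 2)) (fun t => t ^ (p - 1))
      (Set.Ioc 0 s) := by
    intro t ht
    have : t ^ 2 ≤ l := by rw [← hsl]; exact pow_le_pow_left₀ ht.1.le ht.2 2
    simp only
    rw [min_eq_right this, ← Real.rpow_natCast, ← Real.rpow_add ht.1]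
    congr 1; push_cast; ring
  have e2 : Set.EqOn (fun t : ℝ => t ^ (p - 3) * min l (t ^ 2)) (fun t => t ^ (p - 3) * l)
      (Set.Ioi s) := by
    intro t ht
    have : l ≤ t ^ 2 := by rw [← hsl]; exact pow_le_pow_left₀ hs0.le (le_of_lt ht) 2
    simp only
    rw [min_eq_left this]
  have i1 : IntegrableOn (fun t : ℝ => t ^ (p - 1)) (Set.Ioc 0 s) := by
    rw [← intervalIntegrable_iff_integrableOn_Ioc_of_le hs0.le]
    exact intervalIntegral.intervalIntegrable_rpow' (by linarith)
  have i2 : IntegrableOn (fun t : ℝ => t ^ (p - 3) * l) (Set.Ioi s) :=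
    (integrableOn_Ioi_rpow_of_lt (by linarith) hs0).mul_const l
  have j1 := (integrableOn_congr_fun e1 measurableSet_Ioc).2 i1
  have j2 := (integrableOn_congr_fun e2 measurableSet_Ioi).2 i2
  have hu : Set.Ioc 0 s ∪ Set.Ioi s = Set.Ioi 0 := Set.Ioc_union_Ioi_eq_Ioi hs0.le
  refine ⟨hu ▸ j1.union j2, ?_⟩
  have hd : Disjoint (Set.Ioc 0 s) (Set.Ioi s) :=
    Set.disjoint_left.2 fun t h1 h2 => not_lt.2 h1.2 h2
  rw [← hu, setIntegral_union hd measurableSet_Ioi j1 j2, setIntegral_congr_fun measurableSet_Ioc e1,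
    setIntegral_congr_fun measurableSet_Ioi e2, integral_mul_const,
    integral_Ioi_rpow_of_lt (by linarith) hs0, ← intervalIntegral.integral_of_le hs0.le,
    integral_rpow (Or.inl (by linarith)), sub_add_cancel, Real.zero_rpow hp.ne', sub_zero]
  have h1 : l ^ (p / 2) = s ^ p := by
    rw [← hsl, ← Real.rpow_natCast, ← Real.rpow_mul hs0.le]; congr 1; push_cast; ring
  have h2 : s ^ (p - 3 + 1) * l = s ^ p := by
    rw [← hsl, ← Real.rpow_natCast, ← Real.rpow_add hs0]; congr 1; push_cast; ring
  have h3 : -s ^ (p - 3 + 1) / (p - 3 + 1) * l = s ^ p / (2 - p) := by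
    rw [← h2, show p - 3 + 1 = -(2 - p) by ring, neg_div_neg_eq]; ring
  rw [h1, h3]; ring

lemma integral_rpow_mul_indicator {p m : ℝ} (hp2 : p < 2) (hm : 0 < m) :
    IntegrableOn (fun t : ℝ => t ^ (p - 3) * if m < t then 1 else 0) (Set.Ioi 0) ∧
      ∫ t in Set.Ioi (0 : ℝ), t ^ (p - 3) * (if m < t then 1 else 0) = m ^ (p - 2) / (2 - p) := by
  have e : (fun t : ℝ => t ^ (p - 3) * if m < t then (1 : ℝ) else 0) =
      Set.indicator (Set.Ioi m) (fun t => t ^ (p - 3)) := by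
    funext t
    simp [Set.indicator_apply]
  have hsub : Set.Ioi (0 : ℝ) ∩ Set.Ioi m = Set.Ioi m := by
    rw [Set.Ioi_inter_Ioi, max_eq_right hm.le]
  constructor
  · rw [e, IntegrableOn, integrable_indicator_iff measurableSet_Ioi, IntegrableOn,
      Measure.restrict_restrict measurableSet_Ioi, Set.inter_comm, hsub]
    exact integrableOn_Ioi_rpow_of_lt (by linarith) hm
  · rw [e, setIntegral_indicator measurableSet_Ioi, hsub,
      integral_Ioi_rpow_of_lt (by linarith) hm, show p - 3 + 1 = -(2 - p) by ring, neg_div_neg_eq,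
      show p - 2 = -(2 - p) by ring]

variable {α β : Type*} [Fintype α] [Fintype β]

lemma integral_rpow_mul_sum_min {p : ℝ} (hp : 0 < p) (hp2 : p < 2) {a : α → ℝ} (ha : ∀ i, 0 ≤ a i) :
    IntegrableOn (fun t : ℝ => t ^ (p - 3) * ∑ i, min (a i) (t ^ 2)) (Set.Ioi 0) ∧
      ∫ t in Set.Ioi (0 : ℝ), t ^ (p - 3) * ∑ i, min (a i) (t ^ 2) =
        (1 / p + 1 / (2 - p)) * ∑ i, a i ^ (p / 2) := by
  simp only [Finset.mul_sum]
  refine ⟨integrable_finsetSum _ fun i _ => (integral_rpow_mul_min hp hp2 (ha i)).1, ?_⟩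
  rw [integral_finsetSum _ fun i _ => (integral_rpow_mul_min hp hp2 (ha i)).1]
  exact Finset.sum_congr rfl fun i _ => (integral_rpow_mul_min hp hp2 (ha i)).2

/-- A comparison of truncated sums at all levels yields a comparison of `p`-th power sums. -/
lemma sum_rpow_le_of_sum_min_le {p K : ℝ} (hp : 0 < p) (hp2 : p < 2) {a : α → ℝ} {b : β → ℝ}
    (ha : ∀ i, 0 ≤ a i) (hb : ∀ j, 0 ≤ b j)
    (h : ∀ t > 0, ∑ i, min (a i) (t ^ 2) ≤ K * ∑ j, min (b j) (t ^ 2)) :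
    ∑ i, a i ^ (p / 2) ≤ K * ∑ j, b j ^ (p / 2) := by
  obtain ⟨ia, ea⟩ := integral_rpow_mul_sum_min hp hp2 ha
  obtain ⟨ib, eb⟩ := integral_rpow_mul_sum_min hp hp2 hb
  have h1 := setIntegral_mono_on ia (ib.const_mul K) measurableSet_Ioi fun t ht => by
    have ht0 : (0 : ℝ) < t := ht
    calc t ^ (p - 3) * ∑ i, min (a i) (t ^ 2)
        ≤ t ^ (p - 3) * (K * ∑ j, min (b j) (t ^ 2)) := by gcongr; exact h t ht
      _ = K * (t ^ (p - 3) * ∑ j, min (b j) (t ^ 2)) := by ring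
  rw [integral_const_mul, ea, eb] at h1
  have hc : 0 < 1 / p + 1 / (2 - p) := by
    have : 0 < 2 - p := by linarith
    positivity
  refine le_of_mul_le_mul_left (h1.trans (le_of_eq ?_)) hc
  ring

/-- The analogue of `sum_rpow_le_of_sum_min_le` for weighted sums over sublevel sets. -/
lemma sum_mul_rpow_le_of_sum_ite_le {p K : ℝ} (hp : 0 < p) (hp2 : p < 2) {w m : α → ℝ} {b : β → ℝ}
    (hm : ∀ i, 0 ≤ m i) (hw : ∀ i, m i = 0 → w i = 0) (hb : ∀ j, 0 ≤ b j)
    (h : ∀ t > 0, (∑ i, if m i < t then w i else 0) ≤ K * ∑ j, min (b j) (t ^ 2)) :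
    ∑ i, w i * m i ^ (p - 2) ≤ K * (2 / p) * ∑ j, b j ^ (p / 2) := by
  have hi : ∀ i, IntegrableOn (fun t : ℝ => t ^ (p - 3) * if m i < t then w i else 0) (Set.Ioi 0) ∧
      ∫ t in Set.Ioi (0 : ℝ), t ^ (p - 3) * (if m i < t then w i else 0) =
        w i * m i ^ (p - 2) / (2 - p) := by
    intro i
    rcases (hm i).eq_or_lt with h0 | h0
    · simp [hw i h0.symm]
    · obtain ⟨i1, e1⟩ := integral_rpow_mul_indicator hp2 h0
      have e : (fun t : ℝ => t ^ (p - 3) * if m i < t then w i else 0) =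
          fun t => w i * (t ^ (p - 3) * if m i < t then 1 else 0) := by
        funext t; split_ifs <;> ring
      rw [e, integral_const_mul, e1]
      exact ⟨i1.const_mul _, by ring⟩
  obtain ⟨ib, eb⟩ := integral_rpow_mul_sum_min hp hp2 hb
  have h1 := setIntegral_mono_on
    (integrable_finsetSum Finset.univ fun i _ => (hi i).1) (ib.const_mul K) measurableSet_Ioi
    fun t ht => by
      have ht0 : (0 : ℝ) < t := ht
      calc ∑ i, t ^ (p - 3) * (if m i < t then w i else 0)
          = t ^ (p - 3) * ∑ i, (if m i < t then w i else 0) := by rw [Finset.mul_sum]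
        _ ≤ t ^ (p - 3) * (K * ∑ j, min (b j) (t ^ 2)) := by gcongr; exact h t ht
        _ = K * (t ^ (p - 3) * ∑ j, min (b j) (t ^ 2)) := by ring
  rw [integral_finsetSum _ fun i _ => (hi i).1, integral_const_mul, eb] at h1
  simp only [(hi _).2] at h1
  rw [← Finset.sum_div] at h1
  have h2 : 0 < 2 - p := by linarith
  rw [div_le_iff₀ h2] at h1
  refine h1.trans (le_of_eq ?_)
  field_simp
  ring

end LayerCake

section Diagonal

open scoped Matrix.Norms.L2Operator

lemma abs_rpow_add_le {a b θ σ : ℝ} (ha : 0 ≤ a) (hab : a ≤ b) (hb : 0 < b) (hθ : 0 < θ)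
    (hθ1 : θ ≤ 1) (hσ : σ = 1 ∨ σ = -1) :
    |b ^ θ + σ * a ^ θ| ≤ 2 * b ^ (θ - 1) * |b + σ * a| := by
  have h1 : a ^ θ ≤ b ^ θ := Real.rpow_le_rpow ha hab hθ.le
  have h0 : 0 ≤ a ^ θ := Real.rpow_nonneg ha _
  have hb1 : b ^ θ = b ^ (θ - 1) * b := by
    rw [Real.rpow_sub_one hb.ne']; field_simp
  have hc : 0 < b ^ (θ - 1) := Real.rpow_pos_of_pos hb _
  have ha1 : b ^ (θ - 1) * a ≤ a ^ θ := by
    rcases ha.eq_or_lt with rfl | ha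
    · rw [mul_zero]; exact h0
    · have : a ^ θ = a ^ (θ - 1) * a := by rw [Real.rpow_sub_one ha.ne']; field_simp
      rw [this]
      exact mul_le_mul_of_nonneg_right
        (Real.rpow_le_rpow_of_nonpos ha hab (by linarith)) ha.le
  rcases hσ with rfl | rfl
  · rw [one_mul, one_mul, abs_of_nonneg (by positivity), abs_of_nonneg (by positivity)]
    nlinarith [mul_nonneg hc.le ha]
  · rw [abs_of_nonneg (by linarith), abs_of_nonneg (by linarith)]
    nlinarith [mul_nonneg hc.le (sub_nonneg.2 hab)]

variable {ι : Type*} [Fintype ι]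

lemma sum_rpow_mul_rpow_le {s : ℝ} (hs : 0 < s) (hs1 : s < 1) {a b : ι → ℝ} (ha : ∀ i, 0 ≤ a i)
    (hb : ∀ i, 0 ≤ b i) :
    ∑ i, a i ^ (1 - s) * b i ^ s ≤ (∑ i, a i) ^ (1 - s) * (∑ i, b i) ^ s := by
  have h1 : 0 < 1 - s := by linarith
  have hpq : (1 / (1 - s)).HolderConjugate (1 / s) := by
    rw [Real.holderConjugate_iff]
    refine ⟨by rw [lt_div_iff₀ h1]; linarith, ?_⟩
    simp
  have := Real.inner_le_Lp_mul_Lq_of_nonneg (s := Finset.univ) hpq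
    (fun i _ => Real.rpow_nonneg (ha i) (1 - s)) (fun i _ => Real.rpow_nonneg (hb i) s)
  simp only [one_div_one_div] at this
  refine this.trans (le_of_eq ?_)
  congr 3 <;> funext i
  · rw [← Real.rpow_mul (ha i), mul_one_div_cancel h1.ne', Real.rpow_one]
  · rw [← Real.rpow_mul (hb i), mul_one_div_cancel hs.ne', Real.rpow_one]

lemma matrix_rank_add_le (A B : Matrix ι ι ℂ) : (A + B).rank ≤ A.rank + B.rank := by
  have h : (A + B).mulVecLin = A.mulVecLin + B.mulVecLin := Matrix.mulVecLin_add A B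
  rw [Matrix.rank, h]
  exact (Submodule.finrank_mono (LinearMap.range_add_le _ _)).trans
    (Submodule.finrank_add_le_finrank_add_finrank _ _)

variable [DecidableEq ι]

/-- Row and column lengths relative to an ordering of the indices control the Schatten quasi-norm
of a matrix whose entries have symmetric moduli. -/
lemma sum_svSq_rpow_le_columns {q : ℝ} (hq : 0 < q) (hq2 : q < 2) (d : ι → ℝ) (T : Matrix ι ι ℂ)
    (hT : ∀ i j, ‖T i j‖ = ‖T j i‖) :
    ∑ m, svSq T m ^ (q / 2) ≤
      2 * ∑ j, (∑ i, if d i ≤ d j then ‖T i j‖ ^ 2 else 0) ^ (q / 2) := by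
  set c : ι → ℝ := fun j => ∑ i, if d i ≤ d j then ‖T i j‖ ^ 2 else 0 with hc
  have hc0 : ∀ j, 0 ≤ c j := fun j => Finset.sum_nonneg fun i _ => by split_ifs <;> positivity
  refine sum_rpow_le_of_sum_min_le hq hq2 (svSq_nonneg T) hc0 fun t ht => ?_
  set P : Matrix ι ι ℂ := diagonal (fun i => ((if t ^ 2 < c i then 1 else 0 : ℝ) : ℂ)) with hP
  set T₂ : Matrix ι ι ℂ := Matrix.of fun i j => if d i ≤ d j then T i j else 0 with hT₂
  set T₁ : Matrix ι ι ℂ := Matrix.of fun i j => if d i ≤ d j then 0 else T i j with hT₁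
  set H : Matrix ι ι ℂ := T₂ * P + P * T₁ with hH
  have hrank : (H.rank : ℝ) ≤ 2 * ∑ i, if t ^ 2 < c i then 1 else 0 := by
    rw [← rank_diagonal_indicator, ← hP]
    have : H.rank ≤ P.rank + P.rank := (matrix_rank_add_le _ _).trans
      (add_le_add (Matrix.rank_mul_le_right _ _) (Matrix.rank_mul_le_left _ _))
    rw [two_mul]
    exact_mod_cast this
  have hG : frobSq (T - H) ≤ 2 * ∑ j, if t ^ 2 < c j then 0 else c j := by
    have hle : frobSq (T - H) ≤
        (∑ i, ∑ j, if t ^ 2 < c j then 0 else if d i ≤ d j then ‖T i j‖ ^ 2 else 0) +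
        ∑ i, ∑ j, if t ^ 2 < c i then 0 else if d j ≤ d i then ‖T j i‖ ^ 2 else 0 := by
      rw [frobSq, ← Finset.sum_add_distrib]
      refine Finset.sum_le_sum fun i _ => ?_
      rw [← Finset.sum_add_distrib]
      refine Finset.sum_le_sum fun j _ => ?_
      have hij : (T - H) i j = T i j - ((if d i ≤ d j then T i j else 0) *
          ((if t ^ 2 < c j then 1 else 0 : ℝ) : ℂ) +
          ((if t ^ 2 < c i then 1 else 0 : ℝ) : ℂ) * (if d i ≤ d j then 0 else T i j)) := by
        rw [hH, Matrix.sub_apply, Matrix.add_apply, hP, Matrix.mul_diagonal, Matrix.diagonal_mul]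
        rfl
      rw [hij]
      have h2 : 0 ≤ ‖T j i‖ ^ 2 := by positivity
      by_cases h : d i ≤ d j
      · by_cases h' : t ^ 2 < c j
        · simp only [h, h', if_true]
          simp
          split_ifs <;> positivity
        · simp only [h, h', if_true, if_false]
          simp
          split_ifs <;> positivity
      · have h3 : d j ≤ d i := (not_le.1 h).le
        by_cases h' : t ^ 2 < c i
        · simp only [h, h', if_true, if_false]
          simp
        · simp only [h, h', h3, if_true, if_false]
          simp [hT i j]
    refine hle.trans (le_of_eq ?_)
    rw [Finset.sum_comm, two_mul]
    congr 1
    all_goals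
      refine Finset.sum_congr rfl fun j _ => ?_
      split_ifs <;> simp [hc]
  refine (sum_min_svSq_le (sub_add_cancel T H).symm ht).trans ?_
  have hr : t ^ 2 * (H.rank : ℝ) ≤ t ^ 2 * (2 * ∑ i, if t ^ 2 < c i then 1 else 0) := by gcongr
  refine (add_le_add hG hr).trans (le_of_eq ?_)
  rw [mul_left_comm, ← mul_add, Finset.mul_sum, ← Finset.sum_add_distrib]
  congr 1
  refine Finset.sum_congr rfl fun j _ => ?_
  split_ifs with h
  · rw [min_eq_right h.le]; ring
  · rw [min_eq_left (not_lt.1 h)]; ring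

/-- The weighted Hilbert–Schmidt estimate for `x d + σ d x`, with `d` diagonal. -/
lemma sum_weighted_commutator_le {p : ℝ} (hp : 0 < p) (hp2 : p < 2) {d : ι → ℝ}
    (hd : ∀ i, 0 ≤ d i) {x : Matrix ι ι ℂ} (hx : ‖x‖ ≤ 1) {σ : ℝ} (hσ : σ = 1 ∨ σ = -1)
    {D : Matrix ι ι ℂ}
    (hD : D = x * diagonal (fun i => (d i : ℂ)) + (σ : ℂ) • (diagonal (fun i => (d i : ℂ)) * x)) :
    ∑ i, ∑ j, ‖D i j‖ ^ 2 * max (d i) (d j) ^ (p - 2) ≤ 4 * (2 / p) * ∑ m, svSq D m ^ (p / 2) := by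
  have hDij : ∀ i j, D i j = x i j * d j + σ * (d i * x i j) := by
    intro i j
    rw [hD, Matrix.add_apply, Matrix.smul_apply, Matrix.mul_diagonal, Matrix.diagonal_mul,
      smul_eq_mul]
  have key := sum_mul_rpow_le_of_sum_ite_le (α := ι × ι) (K := 4) hp hp2
    (w := fun z => ‖D z.1 z.2‖ ^ 2) (m := fun z => max (d z.1) (d z.2)) (b := svSq D)
    (fun z => le_max_of_le_left (hd _)) ?_ (svSq_nonneg D) ?_
  · rwa [Fintype.sum_prod_type] at key
  · rintro ⟨i, j⟩ hz
    have h1 : d i = 0 := le_antisymm ((le_max_left _ _).trans hz.le) (hd i)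
    have h2 : d j = 0 := le_antisymm ((le_max_right _ _).trans hz.le) (hd j)
    simp [hDij, h1, h2]
  intro t ht
  obtain ⟨G, H, hGH, hle⟩ := exists_decomposition_svSq D t
  set e : ι → ℝ := fun i => if d i < t then 1 else 0 with he
  set P : Matrix ι ι ℂ := diagonal (fun i => (e i : ℂ)) with hP
  set Q : Matrix ι ι ℂ := diagonal (fun i => ((d i * e i : ℝ) : ℂ)) with hQ
  have hPn : ‖P‖ ≤ 1 := by
    rw [hP, Matrix.l2_opNorm_diagonal, pi_norm_le_iff_of_nonneg zero_le_one]
    intro i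
    simp only [he]; split_ifs <;> simp
  have hQn : ‖Q‖ ≤ t := by
    rw [hQ, Matrix.l2_opNorm_diagonal, pi_norm_le_iff_of_nonneg ht.le]
    intro i
    rw [Complex.norm_real]
    simp only [he]
    split_ifs with h
    · rw [mul_one, Real.norm_of_nonneg (hd i)]; exact h.le
    · simpa using ht.le
  have hPDP : P * D * P = P * x * Q + (σ : ℂ) • (Q * x * P) := by
    ext i j
    simp only [hP, hQ, Matrix.mul_diagonal, Matrix.diagonal_mul, Matrix.add_apply,
      Matrix.smul_apply, smul_eq_mul, hDij]
    push_cast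
    ring
  have hσn : ‖(σ : ℂ)‖ = 1 := by rcases hσ with rfl | rfl <;> simp
  have hPx : ‖P * x‖ ≤ 1 := (Matrix.l2_opNorm_mul P x).trans (mul_le_one₀ hPn (norm_nonneg _) hx)
  have hnorm : ‖P * D * P‖ ≤ 2 * t := by
    rw [hPDP]
    refine (norm_add_le _ _).trans ?_
    rw [norm_smul, hσn, one_mul, two_mul]
    refine add_le_add ?_ ?_
    · refine (Matrix.l2_opNorm_mul _ _).trans ?_
      exact (mul_le_mul hPx hQn (norm_nonneg _) zero_le_one).trans_eq (one_mul t)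
    · refine (Matrix.l2_opNorm_mul _ _).trans ((mul_le_of_le_one_right (norm_nonneg _) hPn).trans ?_)
      exact (Matrix.l2_opNorm_mul _ _).trans ((mul_le_of_le_one_right (norm_nonneg _) hx).trans hQn)
  have hsum : P * D * P = P * G * P + P * H * P := by
    rw [hGH, Matrix.mul_add, Matrix.add_mul]
  have h1 := frobSq_le_add_rank hsum hnorm
  have h2 : frobSq (P * G * P) ≤ frobSq G := frobSq_mono fun i j => by
    simp only [hP, Matrix.mul_diagonal, Matrix.diagonal_mul, he]
    split_ifs <;> simp
  have h3 : ((P * H * P).rank : ℝ) ≤ H.rank := by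
    exact_mod_cast (Matrix.rank_mul_le_left _ _).trans (Matrix.rank_mul_le_right _ _)
  have h4 : t ^ 2 * ((P * H * P).rank : ℝ) ≤ t ^ 2 * H.rank := by gcongr
  have h5 : (∑ z : ι × ι, if max (d z.1) (d z.2) < t then ‖D z.1 z.2‖ ^ 2 else 0) =
      frobSq (P * D * P) := by
    rw [Fintype.sum_prod_type, frobSq]
    refine Finset.sum_congr rfl fun i _ => Finset.sum_congr rfl fun j _ => ?_
    simp only [hP, Matrix.mul_diagonal, Matrix.diagonal_mul, he, max_lt_iff]
    by_cases hi : d i < t <;> by_cases hj : d j < t <;> simp [hi, hj]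
  have h6 : 0 ≤ frobSq G := Finset.sum_nonneg fun i _ => Finset.sum_nonneg fun j _ => by positivity
  rw [h5]
  nlinarith

/-- The main estimate in the eigenbasis of `f`. -/
lemma sum_svSq_diagonal_le {p q : ℝ} (hp : 0 < p) (hpq : p < q) (hq1 : q ≤ 1) {d : ι → ℝ}
    (hd : ∀ i, 0 ≤ d i) (hd1 : ∑ i, d i ^ p = 1) {x : Matrix ι ι ℂ} (hxh : x.IsHermitian)
    (hx : ‖x‖ ≤ 1) {σ : ℝ} (hσ : σ = 1 ∨ σ = -1) {D T : Matrix ι ι ℂ}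
    (hD : D = x * diagonal (fun i => (d i : ℂ)) + (σ : ℂ) • (diagonal (fun i => (d i : ℂ)) * x))
    (hT : T = x * diagonal (fun i => ((d i ^ (p / q) : ℝ) : ℂ)) +
      (σ : ℂ) • (diagonal (fun i => ((d i ^ (p / q) : ℝ) : ℂ)) * x)) :
    ∑ m, svSq T m ^ (q / 2) ≤ 2 * 2 ^ q ∧
    ∑ m, svSq T m ^ (q / 2) ≤
      2 * 2 ^ q * (4 * (2 / p) * ∑ m, svSq D m ^ (p / 2)) ^ (q / 2) := by
  have hq : 0 < q := hp.trans hpq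
  set θ := p / q with hθ
  have hθ0 : 0 < θ := by positivity
  have hθ1 : θ ≤ 1 := (div_le_one hq).2 hpq.le
  have hDij : ∀ i j, ‖D i j‖ = ‖x i j‖ * |d j + σ * d i| := by
    intro i j
    rw [hD, Matrix.add_apply, Matrix.smul_apply, Matrix.mul_diagonal, Matrix.diagonal_mul,
      smul_eq_mul, ← Real.norm_eq_abs, ← Complex.norm_real, ← norm_mul]
    congr 1; push_cast; ring
  have hTij : ∀ i j, ‖T i j‖ = ‖x i j‖ * |d j ^ θ + σ * d i ^ θ| := by
    intro i j
    rw [hT, Matrix.add_apply, Matrix.smul_apply, Matrix.mul_diagonal, Matrix.diagonal_mul,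
      smul_eq_mul, ← Real.norm_eq_abs, ← Complex.norm_real, ← norm_mul]
    congr 1; push_cast; ring
  have hTsymm : ∀ i j, ‖T i j‖ = ‖T j i‖ := by
    intro i j
    have : ‖x i j‖ = ‖x j i‖ := by rw [← hxh.apply i j, norm_star]
    rw [hTij, hTij, this]
    congr 1
    rcases hσ with rfl | rfl
    · ring_nf
    · rw [← abs_neg]; ring_nf
  have hcol := sum_svSq_rpow_le_columns hq (by linarith) d T hTsymm
  set c : ι → ℝ := fun j => ∑ i, if d i ≤ d j then ‖T i j‖ ^ 2 else 0 with hc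
  have hc0 : ∀ j, 0 ≤ c j := fun j => Finset.sum_nonneg fun i _ => by split_ifs <;> positivity
  set z : ι → ℝ := fun j => ∑ i, if d i ≤ d j then ‖D i j‖ ^ 2 * d j ^ (p - 2) else 0 with hz
  have hz0 : ∀ j, 0 ≤ z j := fun j => Finset.sum_nonneg fun i _ => by
    have := Real.rpow_nonneg (hd j) (p - 2)
    split_ifs <;> positivity
  have h4 : (4 : ℝ) ^ (q / 2) = 2 ^ q := by
    rw [show (4 : ℝ) = 2 ^ (2 : ℝ) by norm_num, ← Real.rpow_mul (by norm_num)]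
    congr 1; ring
  constructor
  · have hcj : ∀ j, c j ≤ 4 * d j ^ (2 * θ) := by
      intro j
      have hx1 : ∑ i, ‖x i j‖ ^ 2 ≤ 1 :=
        (column_sq_le_opNorm_sq x j).trans (pow_le_one₀ (norm_nonneg _) hx)
      have hdj : 0 ≤ d j ^ θ := Real.rpow_nonneg (hd j) _
      have hdd : d j ^ (2 * θ) = (d j ^ θ) ^ 2 := by
        rw [mul_comm, Real.rpow_mul (hd j)]; norm_num
      rw [hdd]
      calc c j ≤ ∑ i, 4 * (d j ^ θ) ^ 2 * ‖x i j‖ ^ 2 := by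
            refine Finset.sum_le_sum fun i _ => ?_
            split_ifs with h
            · have h1 : d i ^ θ ≤ d j ^ θ := Real.rpow_le_rpow (hd i) h hθ0.le
              have h0 : 0 ≤ d i ^ θ := Real.rpow_nonneg (hd i) _
              have h2 : |d j ^ θ + σ * d i ^ θ| ≤ 2 * d j ^ θ := by
                rw [abs_le]
                rcases hσ with rfl | rfl <;> constructor <;> linarith
              calc ‖T i j‖ ^ 2 = ‖x i j‖ ^ 2 * |d j ^ θ + σ * d i ^ θ| ^ 2 := by
                    rw [hTij, mul_pow]
                _ ≤ ‖x i j‖ ^ 2 * (2 * d j ^ θ) ^ 2 := by gcongr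
                _ = _ := by ring
            · positivity
        _ = 4 * (d j ^ θ) ^ 2 * ∑ i, ‖x i j‖ ^ 2 := by rw [Finset.mul_sum]
        _ ≤ _ := mul_le_of_le_one_right (by positivity) hx1
    have h1 : ∑ j, c j ^ (q / 2) ≤ ∑ j, 2 ^ q * d j ^ p := by
      refine Finset.sum_le_sum fun j _ => ?_
      refine (Real.rpow_le_rpow (hc0 j) (hcj j) (by positivity)).trans (le_of_eq ?_)
      rw [Real.mul_rpow (by norm_num) (Real.rpow_nonneg (hd j) _), h4, ← Real.rpow_mul (hd j)]
      congr 2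
      rw [hθ]; field_simp
    rw [← Finset.mul_sum, hd1, mul_one] at h1
    linarith
  · have hcj : ∀ j, c j ≤ 4 * (d j ^ (2 * θ - p) * z j) := by
      intro j
      rcases (hd j).eq_or_lt with h0 | h0
      · have : c j = 0 := by
          refine Finset.sum_eq_zero fun i _ => ?_
          split_ifs with h
          · have hi : d i = 0 := le_antisymm (h.trans h0.symm.le) (hd i)
            rw [hTij, hi, ← h0, Real.zero_rpow hθ0.ne']
            simp
          · rfl
        rw [this]
        have := Real.rpow_nonneg (hd j) (2 * θ - p)
        have := hz0 j
        positivity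
      · have hpow : d j ^ (2 * θ - p) * d j ^ (p - 2) = (d j ^ (θ - 1)) ^ 2 := by
          rw [← Real.rpow_add h0, ← Real.rpow_natCast, ← Real.rpow_mul h0.le]
          congr 1; push_cast; ring
        rw [hz, Finset.mul_sum, Finset.mul_sum]
        refine Finset.sum_le_sum fun i _ => ?_
        split_ifs with h
        · have h1 := abs_rpow_add_le (hd i) h h0 hθ0 hθ1 hσ
          calc ‖T i j‖ ^ 2 = ‖x i j‖ ^ 2 * |d j ^ θ + σ * d i ^ θ| ^ 2 := by
                rw [hTij, mul_pow]
            _ ≤ ‖x i j‖ ^ 2 * (2 * d j ^ (θ - 1) * |d j + σ * d i|) ^ 2 := by gcongr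
            _ = 4 * (d j ^ (θ - 1)) ^ 2 * (‖x i j‖ * |d j + σ * d i|) ^ 2 := by ring
            _ = _ := by rw [← hpow, hDij]; ring
        · simp
    have h1 : ∑ j, c j ^ (q / 2) ≤ ∑ j, 2 ^ q * ((d j ^ p) ^ (1 - q / 2) * z j ^ (q / 2)) := by
      refine Finset.sum_le_sum fun j _ => ?_
      have hdn := Real.rpow_nonneg (hd j) (2 * θ - p)
      refine (Real.rpow_le_rpow (hc0 j) (hcj j) (by positivity)).trans (le_of_eq ?_)
      rw [Real.mul_rpow (by norm_num) (mul_nonneg hdn (hz0 j)), h4,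
        Real.mul_rpow hdn (hz0 j), ← Real.rpow_mul (hd j), ← Real.rpow_mul (hd j)]
      congr 3
      rw [hθ]; field_simp
    have h2 := sum_rpow_mul_rpow_le (s := q / 2) (by positivity) (by linarith)
      (fun j => Real.rpow_nonneg (hd j) p) hz0
    rw [hd1, Real.one_rpow, one_mul] at h2
    have h3 : ∑ j, z j ≤ 4 * (2 / p) * ∑ m, svSq D m ^ (p / 2) := by
      refine le_trans ?_ (sum_weighted_commutator_le hp (by linarith) hd hx hσ hD)
      rw [Finset.sum_comm]
      refine Finset.sum_le_sum fun j _ => Finset.sum_le_sum fun i _ => ?_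
      split_ifs with h
      · rw [max_eq_right h]
      · have := Real.rpow_nonneg (le_max_of_le_left (hd j) : 0 ≤ max (d j) (d i)) (p - 2)
        exact mul_nonneg (by positivity) this
    have h5 := Real.rpow_le_rpow (Finset.sum_nonneg fun j _ => hz0 j) h3
      (by positivity : 0 ≤ q / 2)
    rw [← Finset.mul_sum] at h1
    have h6 : (0 : ℝ) < 2 ^ q := by positivity
    calc _ ≤ 2 * ∑ j, c j ^ (q / 2) := hcol
      _ ≤ 2 * (2 ^ q * (4 * (2 / p) * ∑ m, svSq D m ^ (p / 2)) ^ (q / 2)) := by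
          gcongr
          exact h1.trans (by gcongr; exact h2.trans h5)
      _ = _ := by ring

end Diagonal

section UnitaryInvariance

variable {ι : Type*} [Fintype ι] [DecidableEq ι]

lemma svSq_unitary_conj (A : Matrix ι ι ℂ) {U : Matrix ι ι ℂ} (hU : star U * U = 1) :
    svSq (U * A * star U) = svSq A := by
  refine (Matrix.IsHermitian.eigenvalues_eq_eigenvalues_iff _ _).2 ?_
  have h : (U * A * star U)ᴴ * (U * A * star U) = U * (Aᴴ * A * star U) := by
    rw [← Matrix.star_eq_conjTranspose, ← Matrix.star_eq_conjTranspose, star_mul, star_mul,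
      star_star]
    calc U * (star A * star U) * (U * A * star U)
        = U * star A * (star U * U) * A * star U := by simp only [Matrix.mul_assoc]
      _ = _ := by rw [hU]; simp only [Matrix.mul_assoc, Matrix.one_mul]
  rw [h, Matrix.charpoly_mul_comm, Matrix.mul_assoc, hU, Matrix.mul_one]

lemma sum_svSq_diagonal_rpow {d : ι → ℝ} (hd : ∀ i, 0 ≤ d i) (p : ℝ) :
    ∑ i, svSq (diagonal fun i => (d i : ℂ)) i ^ (p / 2) = ∑ i, d i ^ p := by
  have hA := isHermitian_conjTranspose_mul_self (diagonal fun i => (d i : ℂ))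
  have h2 : (diagonal fun i => (d i : ℂ))ᴴ * (diagonal fun i => (d i : ℂ)) =
      diagonal fun i => ((d i ^ 2 : ℝ) : ℂ) := by
    rw [Matrix.diagonal_conjTranspose, Matrix.diagonal_mul_diagonal]
    congr 1; funext i; simp [sq]
  have h1 := congrArg (fun M : Matrix ι ι ℂ => M.charpoly.roots) h2
  rw [hA.roots_charpoly_eq_eigenvalues, Matrix.charpoly_diagonal, Polynomial.roots_prod _ _
    (Finset.prod_ne_zero_iff.2 fun i _ => Polynomial.X_sub_C_ne_zero _)] at h1
  simp only [Polynomial.roots_X_sub_C, Multiset.bind_singleton] at h1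
  have h3 := congrArg (fun m : Multiset ℂ => (m.map fun w => w.re ^ (p / 2)).sum) h1
  simp only [Multiset.map_map, Function.comp_def, Complex.ofReal_re] at h3
  have h4 : ∀ i, (d i ^ 2) ^ (p / 2) = d i ^ p := fun i => by
    rw [← Real.rpow_natCast, ← Real.rpow_mul (hd i)]; congr 1; push_cast; ring
  calc _ = ∑ i, (d i ^ 2) ^ (p / 2) := h3
    _ = _ := Finset.sum_congr rfl fun i _ => h4 i

end UnitaryInvariance

open scoped Matrix.Norms.L2Operator in
/-- The estimate of the power sums of singular values for a general positive semidefinite `f`. -/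
lemma sum_svSq_commutator_le {ι : Type*} [Fintype ι] [DecidableEq ι] {p q : ℝ} (hp : 0 < p)
    (hpq : p < q) (hq1 : q ≤ 1) {x f : Matrix ι ι ℂ} {σ : ℝ} (hxh : x.IsHermitian)
    (hx : opNorm x ≤ 1) (hf : f.PosSemidef) (hf1 : schattenNorm p f = 1) (hσ : σ = 1 ∨ σ = -1) :
    ∑ m, svSq (x * posPow f (p / q) + (σ : ℂ) • (posPow f (p / q) * x)) m ^ (q / 2) ≤ 2 * 2 ^ q ∧
    ∑ m, svSq (x * posPow f (p / q) + (σ : ℂ) • (posPow f (p / q) * x)) m ^ (q / 2) ≤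
      2 * 2 ^ q * (4 * (2 / p) * ∑ m, svSq (x * f + (σ : ℂ) • (f * x)) m ^ (p / 2)) ^ (q / 2) := by
  set U : Matrix ι ι ℂ := (hf.1.eigenvectorUnitary : Matrix ι ι ℂ) with hUdef
  have hU : star U * U = 1 := Unitary.coe_star_mul_self _
  have hU' : U * star U = 1 := Unitary.coe_mul_star_self _
  set d := hf.1.eigenvalues with hd
  have hd0 : ∀ i, 0 ≤ d i := hf.eigenvalues_nonneg
  have hfU : f = U * diagonal (fun i => (d i : ℂ)) * star U := by
    have := hf.1.spectral_theorem
    rw [Unitary.conjStarAlgAut_apply] at this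
    exact this
  have hpow : posPow f (p / q) = U * diagonal (fun i => ((d i ^ (p / q) : ℝ) : ℂ)) * star U := by
    rw [posPow, dif_pos hf.1, Matrix.IsHermitian.cfc, Unitary.conjStarAlgAut_apply]
    rfl
  have hd1 : ∑ i, d i ^ p = 1 := by
    rw [schattenNorm_eq, hfU, svSq_unitary_conj _ hU, sum_svSq_diagonal_rpow hd0] at hf1
    have h0 : 0 ≤ ∑ i, d i ^ p := Finset.sum_nonneg fun i _ => Real.rpow_nonneg (hd0 i) _
    calc ∑ i, d i ^ p = ((∑ i, d i ^ p) ^ (1 / p)) ^ p := by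
          rw [← Real.rpow_mul h0, one_div_mul_cancel hp.ne', Real.rpow_one]
      _ = 1 := by rw [hf1, Real.one_rpow]
  set y := star U * x * U with hy
  have hyh : y.IsHermitian := Matrix.isHermitian_conjTranspose_mul_mul U hxh
  have hxy : x = U * y * star U := by
    calc x = (U * star U) * x * (U * star U) := by rw [hU', Matrix.one_mul, Matrix.mul_one]
      _ = _ := by simp only [hy, Matrix.mul_assoc]
  have hUn : ‖U‖ ≤ 1 := opNorm_le_one_of_star_mul_self hU
  have hUn' : ‖star U‖ ≤ 1 := by rwa [norm_star]
  have hyn : ‖y‖ ≤ 1 :=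
    (Matrix.l2_opNorm_mul _ _).trans (mul_le_one₀ ((Matrix.l2_opNorm_mul _ _).trans
      (mul_le_one₀ hUn' (norm_nonneg _) hx)) (norm_nonneg _) hUn)
  have hconj : ∀ g : Matrix ι ι ℂ, x * (U * g * star U) + (σ : ℂ) • ((U * g * star U) * x) =
      U * (y * g + (σ : ℂ) • (g * y)) * star U := by
    intro g
    have e : ∀ a b : Matrix ι ι ℂ, (U * a * star U) * (U * b * star U) = U * (a * b) * star U := by
      intro a b
      calc (U * a * star U) * (U * b * star U) = U * a * (star U * U) * b * star U := by
            simp only [Matrix.mul_assoc]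
        _ = _ := by rw [hU, Matrix.mul_one]; simp only [Matrix.mul_assoc]
    rw [hxy, e, e, Matrix.mul_add, Matrix.add_mul, Matrix.mul_smul, Matrix.smul_mul]
  have h1 : svSq (x * posPow f (p / q) + (σ : ℂ) • (posPow f (p / q) * x)) =
      svSq (y * diagonal (fun i => ((d i ^ (p / q) : ℝ) : ℂ)) +
        (σ : ℂ) • (diagonal (fun i => ((d i ^ (p / q) : ℝ) : ℂ)) * y)) := by
    rw [hpow, hconj, svSq_unitary_conj _ hU]
  have h2 : svSq (x * f + (σ : ℂ) • (f * x)) =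
      svSq (y * diagonal (fun i => (d i : ℂ)) + (σ : ℂ) • (diagonal (fun i => (d i : ℂ)) * y)) := by
    rw [← svSq_unitary_conj (y * diagonal (fun i => (d i : ℂ)) + _) hU, ← hconj, ← hfU]
  rw [h1, h2]
  exact sum_svSq_diagonal_le hp hpq hq1 hd0 hd1 hyh hyn hσ rfl rfl

lemma rpow_le_of_le_rpow {p q R A F E : ℝ} (hp : 0 < p) (hq : 0 < q) (hR : 0 < R) (hRq : R ≤ q)
    (hA : 0 ≤ A) (hF : 0 ≤ F) (hE : 0 ≤ E) {B : ℝ} (hB : 0 ≤ B) (h1 : F ≤ A)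
    (h2 : F ≤ A * (B * E) ^ (q / 2)) :
    F ^ (1 / q) ≤ (A * max 1 (B ^ (q / 2))) ^ (1 / q) * (E ^ (1 / p)) ^ (p * R / (2 * q)) := by
  set K : ℝ := max 1 (B ^ (q / 2)) with hK
  have hK1 : 1 ≤ K := le_max_left _ _
  have hK0 : 0 ≤ K := zero_le_one.trans hK1
  have hER : 0 ≤ E ^ (R / 2) := Real.rpow_nonneg hE _
  have hFE : F ≤ A * K * E ^ (R / 2) := by
    rw [mul_assoc]
    rcases le_total E 1 with hE1 | hE1
    · have h3 : E ^ (q / 2) ≤ E ^ (R / 2) := by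
        rcases hE.eq_or_lt with rfl | hE0
        · rw [Real.zero_rpow (by positivity), Real.zero_rpow (by positivity)]
        · exact Real.rpow_le_rpow_of_exponent_ge hE0 hE1 (by linarith)
      rw [Real.mul_rpow hB hE] at h2
      refine h2.trans (mul_le_mul_of_nonneg_left ?_ hA)
      exact mul_le_mul (le_max_right _ _) h3 (Real.rpow_nonneg hE _) hK0
    · have h3 : 1 ≤ E ^ (R / 2) := Real.one_le_rpow hE1 (by positivity)
      exact h1.trans (le_mul_of_one_le_right hA (one_le_mul_of_one_le_of_one_le hK1 h3))
  refine (Real.rpow_le_rpow hF hFE (by positivity)).trans (le_of_eq ?_)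
  rw [Real.mul_rpow (mul_nonneg hA hK0) hER, ← Real.rpow_mul hE, ← Real.rpow_mul hE]
  congr 2
  field_simp

/-- The Hölder-type inequality with `s = ∞`, in the form used for the Mazur maps. -/
theorem statement2 (p q R : ℝ) (hp : 0 < p) (hpq : p < q) (hq1 : q ≤ 1)
    (hR0 : 0 < R) (hRp : R < p) :
    ∃ C : ℝ, 0 < C ∧ ∀ (n : ℕ) (x f : Matrix (Fin n) (Fin n) ℂ) (σ : ℝ),
      x.IsHermitian → opNorm x ≤ 1 → f.PosSemidef → schattenNorm p f = 1 →
      (σ = 1 ∨ σ = -1) →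
      schattenNorm q (x * posPow f (p / q) + (σ : ℂ) • (posPow f (p / q) * x)) ≤
        C * schattenNorm p (x * f + (σ : ℂ) • (f * x)) ^ (p * R / (2 * q)) := by
  have hq : 0 < q := hp.trans hpq
  have h2q : (0 : ℝ) < 2 ^ q := by positivity
  refine ⟨(2 * 2 ^ q * max 1 ((4 * (2 / p)) ^ (q / 2))) ^ (1 / q), by positivity, ?_⟩
  intro n x f σ hxh hx hf hf1 hσ
  obtain ⟨h1, h2⟩ := sum_svSq_commutator_le hp hpq hq1 hxh hx hf hf1 hσ
  rw [schattenNorm_eq, schattenNorm_eq]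
  exact rpow_le_of_le_rpow hp hq hR0 (hRp.le.trans hpq.le) (by positivity)
    (svSq_rpow_sum_nonneg _ _) (svSq_rpow_sum_nonneg _ _) (by positivity) h1 h2
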